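/- Let $K$ be a compact metric space and $\mu : \partial\Omega \to \mathscr{M}(\overline{\Omega})$ (with $\partial\Omega$ a compact metric space and $\overline{\Omega}$ compact) be such that for every Borel set $A \subseteq \overline{\Omega}$ the map $z \mapsto \mu(z)(A)$ is continuous. Then: (i) $\sup_{z} \|\mu(z)\| < \infty$ (total variation norms are uniformly bounded), and (ii) there exists a finite positive measure $\tau$ on $\overline{\Omega}$ such that $\mu(z) \ll \tau$ for every $z$. -/

import Mathlib

open MeasureTheory Filter Topology Set

section NikodymBoundedness

variable {X ι : Type*} [MeasurableSpace X]

/-- A complex measure of the union of a subfamily of a disjoint sequence depends continuously on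
the subfamily. -/
theorem MeasureTheory.ComplexMeasure.continuous_iUnion_ite (ν : ComplexMeasure X) {F : ℕ → Set X}
    (hF : ∀ n, MeasurableSet (F n)) (hd : Pairwise fun m n => Disjoint (F m) (F n)) :
    Continuous fun x : ℕ → Bool => ν (⋃ n, if x n then F n else ∅) := by
  have hsum (x : ℕ → Bool) :
      ν (⋃ n, if x n then F n else ∅) = ∑' n, if x n then ν (F n) else 0 := by
    rw [ν.of_disjoint_iUnion (fun n => ?_) (fun m n hmn => ?_)]
    · exact tsum_congr fun n => by split_ifs <;> simp
    · split_ifs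
      exacts [hF n, .empty]
    · simp only [Function.onFun]
      split_ifs <;> simp [hd hmn]
  simp_rw [hsum]
  refine continuous_tsum (fun n => ?_) (ν.hasSum_of_disjoint_iUnion hF hd).summable.norm
    fun n x => ?_
  · exact (continuous_of_discreteTopology (f := fun b : Bool => if b then ν (F n) else 0)).comp
      (continuous_apply n)
  · split_ifs <;> simp

/-- A setwise bounded family of complex measures is bounded along any disjoint sequence. -/
theorem MeasureTheory.ComplexMeasure.exists_bound_of_disjoint (μ : ι → ComplexMeasure X)
    (hμ : ∀ A, MeasurableSet A → ∃ C : ℝ, ∀ i, ‖μ i A‖ ≤ C) {F : ℕ → Set X}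
    (hF : ∀ n, MeasurableSet (F n)) (hd : Pairwise fun m n => Disjoint (F m) (F n)) :
    ∃ C : ℝ, ∀ᶠ n in atTop, ∀ i, ‖μ i (F n)‖ ≤ C := by
  let U (x : ℕ → Bool) : Set X := ⋃ n, if x n then F n else ∅
  have hU (x : ℕ → Bool) : MeasurableSet (U x) := .iUnion fun n => by
    split_ifs
    exacts [hF n, .empty]
  obtain ⟨N, x, hx⟩ : ∃ N : ℕ, (interior {x | ∀ i, ‖μ i (U x)‖ ≤ N}).Nonempty := by
    refine nonempty_interior_of_iUnion_of_closed (fun N => ?_) (eq_univ_of_forall fun x => ?_)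
    · simp only [ofPred_forall]
      exact isClosed_iInter fun i =>
        isClosed_le ((μ i).continuous_iUnion_ite hF hd).norm continuous_const
    · obtain ⟨C, hC⟩ := hμ (U x) (hU x)
      obtain ⟨N, hN⟩ := exists_nat_ge C
      exact mem_iUnion.2 ⟨N, fun i => (hC i).trans hN⟩
  have hlim (b : Bool) : Tendsto (fun n => Function.update x n b) atTop (𝓝 x) := by
    refine tendsto_pi_nhds.2 fun m => tendsto_const_nhds.congr' ?_
    filter_upwards [eventually_gt_atTop m] with n hn
    rw [Function.update_of_ne hn.ne]
  have hmem (b : Bool) := (hlim b).eventually (mem_interior_iff_mem_nhds.1 hx)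
  refine ⟨N + N, ?_⟩
  filter_upwards [hmem true, hmem false] with n ht hf i
  have hunion : U (Function.update x n true) = U (Function.update x n false) ∪ F n := by
    ext p
    simp only [U, mem_iUnion, mem_union]
    constructor
    · rintro ⟨m, hm⟩
      rcases eq_or_ne m n with rfl | hmn
      · exact .inr (by simpa using hm)
      · exact .inl ⟨m, by simpa [Function.update_of_ne hmn] using hm⟩
    · rintro (⟨m, hm⟩ | hp)
      · rcases eq_or_ne m n with rfl | hmn
        · simp at hm
        · exact ⟨m, by simpa [Function.update_of_ne hmn] using hm⟩
      · exact ⟨n, by simpa using hp⟩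
  have hdisj : Disjoint (U (Function.update x n false)) (F n) := by
    refine disjoint_iUnion_left.2 fun m => ?_
    rcases eq_or_ne m n with rfl | hmn
    · simp
    · split_ifs <;> simp [hd hmn]
  have hadd := (μ i).of_union hdisj (hU _) (hF n)
  rw [← hunion] at hadd
  rw [← sub_eq_of_eq_add' hadd]
  exact (norm_sub_le _ _).trans (add_le_add (ht i) (hf i))

/-- **Nikodym boundedness theorem**: a setwise bounded family of complex measures is uniformly
bounded. -/
theorem MeasureTheory.ComplexMeasure.exists_bound_of_setwise_bounded (μ : ι → ComplexMeasure X)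
    (hμ : ∀ A, MeasurableSet A → ∃ C : ℝ, ∀ i, ‖μ i A‖ ≤ C) :
    ∃ C : ℝ, ∀ i A, MeasurableSet A → ‖μ i A‖ ≤ C := by
  let Bad (E : Set X) : Prop := MeasurableSet E ∧
    ∀ C : ℝ, ∃ i A, MeasurableSet A ∧ A ⊆ E ∧ C < ‖μ i A‖
  by_contra! hunb
  have hstart : Bad univ := by
    refine ⟨.univ, fun C => ?_⟩
    obtain ⟨i, A, hA, h⟩ := hunb C
    exact ⟨i, A, hA, subset_univ A, h⟩
  have hsplit {E A : Set X} (hE : Bad E) (hA : MeasurableSet A) (hAE : A ⊆ E) :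
      Bad A ∨ Bad (E \ A) := by
    by_contra! h
    obtain ⟨C₁, h₁⟩ : ∃ C₁ : ℝ, ∀ i B, MeasurableSet B → B ⊆ A → ‖μ i B‖ ≤ C₁ := by
      simpa [Bad, hA] using h.1
    obtain ⟨C₂, h₂⟩ : ∃ C₂ : ℝ, ∀ i B, MeasurableSet B → B ⊆ E \ A → ‖μ i B‖ ≤ C₂ := by
      simpa only [Bad, hE.1.diff hA, true_and, not_forall, not_exists, not_and, not_lt] using h.2
    obtain ⟨i, B, hB, hBE, hlt⟩ := hE.2 (C₁ + C₂)
    have hadd : μ i B = μ i (B ∩ A) + μ i (B \ A) := by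
      rw [← (μ i).of_union (disjoint_sdiff_right.mono_left inter_subset_right) (hB.inter hA)
        (hB.diff hA), inter_union_sdiff]
    have := h₁ i (B ∩ A) (hB.inter hA) inter_subset_right
    have := h₂ i (B \ A) (hB.diff hA) (sdiff_subset_sdiff_left hBE)
    have := norm_add_le (μ i (B ∩ A)) (μ i (B \ A))
    rw [hadd] at hlt
    linarith
  have hstep (n : ℕ) (E : {E // Bad E}) :
      ∃ E' : {E // Bad E}, E'.1 ⊆ E.1 ∧ ∃ i, (n : ℝ) < ‖μ i (E.1 \ E'.1)‖ := by
    obtain ⟨E, hE⟩ := E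
    obtain ⟨C, hC⟩ := hμ E hE.1
    obtain ⟨i, A, hA, hAE, hlt⟩ := hE.2 (n + C)
    have hEi := hC i
    have hC0 : 0 ≤ C := (norm_nonneg _).trans hEi
    rcases hsplit hE hA hAE with h | h
    · refine ⟨⟨A, h⟩, hAE, i, ?_⟩
      have hsub : μ i (E \ A) = μ i E - μ i A :=
        eq_sub_of_add_eq' ((μ i).of_add_of_sdiff hA hE.1 hAE)
      have := norm_sub_norm_le (μ i A) (μ i E)
      rw [norm_sub_rev, ← hsub] at this
      change (n : ℝ) < ‖μ i (E \ A)‖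
      linarith
    · refine ⟨⟨E \ A, h⟩, sdiff_subset, i, ?_⟩
      change (n : ℝ) < ‖μ i (E \ (E \ A))‖
      rw [sdiff_sdiff_cancel_left hAE]
      linarith
  choose succ hsucc hlarge using hstep
  let E (n : ℕ) : {E // Bad E} := Nat.rec ⟨univ, hstart⟩ succ n
  have hanti : Antitone fun n => (E n).1 := antitone_nat_of_succ_le fun n => hsucc n (E n)
  have hd : Pairwise fun m n => Disjoint ((E m).1 \ (E (m + 1)).1) ((E n).1 \ (E (n + 1)).1) := by
    refine (pairwise_disjoint_on _).2 fun m n hmn => ?_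
    exact disjoint_sdiff_left.mono_right (sdiff_subset.trans (hanti hmn))
  obtain ⟨C, hC⟩ := ComplexMeasure.exists_bound_of_disjoint μ hμ
    (fun n => (E n).2.1.diff (E (n + 1)).2.1) hd
  obtain ⟨n, hn, hCn⟩ := (hC.and (eventually_ge_atTop ⌈C⌉₊)).exists
  obtain ⟨i, hi⟩ := hlarge n (E n)
  exact (hi.trans_le (hn i)).not_ge (Nat.ceil_le.1 hCn)

end NikodymBoundedness

/-- A complex measure is dominated by a finite measure. -/
theorem MeasureTheory.ComplexMeasure.exists_isFiniteMeasure_dominating {X : Type*}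
    [MeasurableSpace X] (ν : ComplexMeasure X) :
    ∃ τ : Measure X, IsFiniteMeasure τ ∧ ∀ A, τ A = 0 → ν A = 0 := by
  refine ⟨(ComplexMeasure.re ν).totalVariation + (ComplexMeasure.im ν).totalVariation,
    inferInstance, fun A hA => ?_⟩
  rw [Measure.add_apply, add_eq_zero] at hA
  have hre : (ν A).re = 0 := SignedMeasure.null_of_totalVariation_zero _ hA.1
  have him : (ν A).im = 0 := SignedMeasure.null_of_totalVariation_zero _ hA.2
  exact Complex.ext hre him

/-- Let `Z` (playing the role of `∂Ω`) and `K` (playing the role of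
`\overline{Ω}`) be compact metric spaces and `μ : Z → 𝓜(K)` a map into the complex Borel
measures such that for every Borel set `A ⊆ K` the map `z ↦ μ(z)(A)` is continuous.  Then
(i) `sup_z ‖μ(z)‖ < ∞` (the values `μ(z)(A)` are uniformly bounded), and (ii) there is a
finite positive measure `τ` on `K` with `μ(z) ≪ τ` for every `z`. -/
theorem stmt14 {Z K : Type*}
    [MetricSpace Z] [CompactSpace Z]
    [MetricSpace K] [CompactSpace K] [MeasurableSpace K] [BorelSpace K]
    (μ : Z → ComplexMeasure K)
    (hcont : ∀ A : Set K, MeasurableSet A → Continuous fun z => μ z A) :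
    (∃ C : ℝ, ∀ (z : Z) (A : Set K), MeasurableSet A → ‖μ z A‖ ≤ C) ∧
    (∃ τ : Measure K, IsFiniteMeasure τ ∧
      ∀ (z : Z) (A : Set K), MeasurableSet A → τ A = 0 → μ z A = 0) := by
  refine ⟨ComplexMeasure.exists_bound_of_setwise_bounded μ fun A hA => ?_, ?_⟩
  · obtain ⟨C, hC⟩ := isCompact_univ.exists_bound_of_continuousOn (hcont A hA).continuousOn
    exact ⟨C, fun z => hC z (mem_univ z)⟩
  · choose σ hσ hdom using fun z => (μ z).exists_isFiniteMeasure_dominating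
    obtain ⟨s, hs, hdense⟩ := TopologicalSpace.exists_countable_dense Z
    have := hs.to_subtype
    refine ⟨(Measure.sum fun z : s => σ z).toFinite, inferInstance, fun z A hA h => ?_⟩
    have hzero := absolutelyContinuous_toFinite _ h
    rw [Measure.sum_apply_eq_zero] at hzero
    have heq : (fun z => μ z A) = fun _ => 0 :=
      (hcont A hA).ext_on hdense continuous_const fun w hw => hdom w A (hzero ⟨w, hw⟩)
    exact congrFun heq z
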